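/- arXiv:2601.10380 — 2 statements merged into one kernel-verified Lean document; each statement's English description precedes it below -/
import Mathlib

section
/- Let H₀ be an N×N complex Hermitian matrix, let k ∈ {1,…,N}, and suppose the k-th smallest eigenvalue E_k of H₀ (eigenvalues counted with multiplicity) is simple and separated from every other eigenvalue of H₀ by a distance of at least Δ > 0. Let φ be a unit eigenvector of H₀ for E_k, and let V be an N×N Hermitian matrix with ‖V‖ ≤ Δ/3, where ‖·‖ is the spectral norm (operator norm induced by the Euclidean norm on ℂ^N). Then the k-th smallest eigenvalue of H₀ + V is simple, and for every unit eigenvector ψ of H₀ + V corresponding to its k-th smallest eigenvalue there exists θ ∈ [0, 2π) such that ‖ψ − e^{iθ} φ‖ ≤ 3‖V‖/Δ. -/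
open Matrix

noncomputable def specNorm {n : Type*} [Fintype n] [DecidableEq n] (A : Matrix n n ℂ) : ℝ :=
  ‖Matrix.toEuclideanCLM (𝕜 := ℂ) A‖

noncomputable def kthSmallest {ι : Type*} [Fintype ι] (f : ι → ℝ) (k : ℕ) : ℝ :=
  ((Finset.univ.val.map f).sort (· ≤ ·)).getD k 0

noncomputable def euclNorm {ι : Type*} [Fintype ι] (v : ι → ℂ) : ℝ :=
  ‖((WithLp.equiv 2 (ι → ℂ)).symm v : EuclideanSpace ℂ ι)‖

section KthSmallest

lemma List.Pairwise.getD_le_iff_lt_countP {l : List ℝ} (hl : l.Pairwise (· ≤ ·)) (d t : ℝ)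
    {k : ℕ} (hk : k < l.length) :
    l.getD k d ≤ t ↔ k < l.countP (· ≤ t) := by
  induction l generalizing k with
  | nil => simp at hk
  | cons a l ih =>
    obtain ⟨ha, hl⟩ := List.pairwise_cons.1 hl
    by_cases hat : a ≤ t
    · cases k with
      | zero => simp [hat]
      | succ k => simpa [List.countP_cons, hat] using ih hl (by simpa using hk)
    · have hcount : l.countP (· ≤ t) = 0 := by
        rw [List.countP_eq_zero]
        intro b hb
        simpa using (not_le.1 hat).trans_le (ha b hb)
      cases k with
      | zero => simp [hat, hcount]
      | succ k =>
        have := ih hl (k := k) (by simpa using hk)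
        simp only [hcount, not_lt_zero, iff_false] at this
        simpa [List.countP_cons, hat, hcount] using this

variable {ι : Type*} [Fintype ι]

lemma kthSmallest_le_iff (f : ι → ℝ) {k : ℕ} (hk : k < Fintype.card ι) (t : ℝ) :
    kthSmallest f k ≤ t ↔ k < (Finset.univ.filter (fun i => f i ≤ t)).card := by
  rw [kthSmallest, (Multiset.pairwise_sort _ _).getD_le_iff_lt_countP]
  · rw [← Multiset.coe_countP, Multiset.sort_eq, Multiset.countP_map]
    rfl
  · simpa using hk

lemma exists_eq_kthSmallest (f : ι → ℝ) {k : ℕ} (hk : k < Fintype.card ι) :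
    ∃ i, f i = kthSmallest f k := by
  have hk' : k < ((Finset.univ.val.map f).sort (· ≤ ·)).length := by simpa using hk
  have hmem := List.getElem_mem hk'
  rw [Multiset.mem_sort, Multiset.mem_map] at hmem
  obtain ⟨i, -, hi⟩ := hmem
  exact ⟨i, by rw [hi, kthSmallest, List.getD_eq_getElem _ _ hk']⟩

lemma kthSmallest_le_add {f g : ι → ℝ} {v : ℝ}
    (hfg : ∀ t, (Finset.univ.filter (fun i => f i ≤ t)).card ≤
      (Finset.univ.filter (fun i => g i ≤ t + v)).card)
    {k : ℕ} (hk : k < Fintype.card ι) :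
    kthSmallest g k ≤ kthSmallest f k + v := by
  rw [kthSmallest_le_iff g hk]
  exact ((kthSmallest_le_iff f hk _).1 le_rfl).trans_le (hfg _)

/-- If the counting functions of `f` and `g` interlace up to a shift by `v`, an isolated simple
`k`-th smallest value of `f` forces the `k`-th smallest value of `g` to be simple. -/
lemma existsUnique_eq_kthSmallest {f g : ι → ℝ} {v Δ : ℝ} (hΔ : 0 < Δ) (hv : v ≤ Δ / 3)
    (hfg : ∀ t, (Finset.univ.filter (fun i => f i ≤ t)).card ≤
      (Finset.univ.filter (fun i => g i ≤ t + v)).card)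
    (hgf : ∀ t, (Finset.univ.filter (fun i => g i ≤ t)).card ≤
      (Finset.univ.filter (fun i => f i ≤ t + v)).card)
    {k : ℕ} (hk : k < Fintype.card ι)
    (hsimple : ∃! i, f i = kthSmallest f k)
    (hgap : ∀ i, f i ≠ kthSmallest f k → Δ ≤ |f i - kthSmallest f k|) :
    ∃! i, g i = kthSmallest g k := by
  classical
  set e := kthSmallest f k
  have h_low : ∀ t, t < e → (Finset.univ.filter (fun i => f i ≤ t)).card ≤ k := fun t ht => by
    by_contra! h
    exact absurd ((kthSmallest_le_iff f hk t).2 h) (not_le.2 ht)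
  have h_high : (Finset.univ.filter (fun i => f i ≤ e + 5 * Δ / 6)).card ≤ k + 1 := by
    obtain ⟨i₀, hi₀, huniq⟩ := hsimple
    have hsub : Finset.univ.filter (fun i => f i ≤ e + 5 * Δ / 6) ⊆
        insert i₀ (Finset.univ.filter (fun i => f i ≤ e - Δ)) := by
      intro i hi
      simp only [Finset.mem_filter, Finset.mem_univ, true_and, Finset.mem_insert] at hi ⊢
      by_cases hie : f i = e
      · exact Or.inl (huniq i hie)
      · right
        rcases le_abs.1 (hgap i hie) with h | h <;> linarith
    calc _ ≤ _ := Finset.card_le_card hsub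
      _ ≤ _ := Finset.card_insert_le _ _
      _ ≤ k + 1 := by gcongr; exact h_low _ (by linarith)
  have mono : ∀ {s t : ℝ}, s ≤ t → (Finset.univ.filter (fun i => f i ≤ s)).card ≤
      (Finset.univ.filter (fun i => f i ≤ t)).card := fun hst =>
    Finset.card_le_card (Finset.monotone_filter_right _ fun i _ hi => le_trans hi hst)
  have hg_high : (Finset.univ.filter (fun i => g i ≤ e + Δ / 2)).card ≤ k + 1 :=
    (hgf _).trans ((mono (by linarith)).trans h_high)
  have hf_low : k ≤ (Finset.univ.filter (fun i => f i ≤ e - 5 * Δ / 6)).card := by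
    obtain ⟨i₀, hi₀, huniq⟩ := hsimple
    have hsub : Finset.univ.filter (fun i => f i ≤ e) ⊆
        insert i₀ (Finset.univ.filter (fun i => f i ≤ e - 5 * Δ / 6)) := by
      intro i hi
      simp only [Finset.mem_filter, Finset.mem_univ, true_and, Finset.mem_insert] at hi ⊢
      by_cases hie : f i = e
      · exact Or.inl (huniq i hie)
      · right
        rcases le_abs.1 (hgap i hie) with h | h <;> linarith
    have h1 := (kthSmallest_le_iff f hk e).1 le_rfl
    have h2 := (Finset.card_le_card hsub).trans (Finset.card_insert_le _ _)
    omega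
  have hg_low : k ≤ (Finset.univ.filter (fun i => g i ≤ e - Δ / 2)).card := by
    refine hf_low.trans ((hfg _).trans (Finset.card_le_card ?_))
    exact Finset.monotone_filter_right _ fun i _ hi => le_trans hi (by linarith)
  have he_high : kthSmallest g k ≤ e + Δ / 2 :=
    (kthSmallest_le_add hfg hk).trans (by linarith)
  have he_low : e - Δ / 2 < kthSmallest g k := by
    have := kthSmallest_le_add hgf hk
    linarith
  obtain ⟨i, hi⟩ := exists_eq_kthSmallest g hk
  refine ⟨i, hi, fun j hj => ?_⟩
  by_contra hji
  have hsub : insert i (insert j (Finset.univ.filter (fun i => g i ≤ e - Δ / 2))) ⊆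
      Finset.univ.filter (fun i => g i ≤ e + Δ / 2) := by
    intro m hm
    simp only [Finset.mem_filter, Finset.mem_univ, true_and, Finset.mem_insert] at hm ⊢
    rcases hm with rfl | rfl | hm <;> linarith
  have hcard := Finset.card_le_card hsub
  rw [Finset.card_insert_of_notMem, Finset.card_insert_of_notMem] at hcard
  · omega
  · simp only [Finset.mem_filter, Finset.mem_univ, true_and, hj, not_le, he_low]
  · simp only [Finset.mem_filter, Finset.mem_univ, true_and, Finset.mem_insert, hi, not_or, not_le,
      he_low, and_true]
    exact fun h => hji h.symm

end KthSmallest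

section InnerProductSpace

variable {ι E : Type*} [Fintype ι] [NormedAddCommGroup E] [InnerProductSpace ℂ E]

lemma OrthonormalBasis.re_inner_apply_eq_sum (b : OrthonormalBasis ι ℂ E) {T : E →L[ℂ] E}
    {f : ι → ℝ} (hb : ∀ i, T (b i) = (f i : ℂ) • b i) (x : E) :
    (inner ℂ x (T x)).re = ∑ i, f i * ‖inner ℂ (b i) x‖ ^ 2 := by
  have hx : T x = ∑ i, inner ℂ (b i) x • (f i : ℂ) • b i := by
    conv_lhs => rw [← b.sum_repr' x]
    simp [map_sum, hb]
  rw [hx, inner_sum, Complex.re_sum]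
  refine Finset.sum_congr rfl fun i _ => ?_
  rw [inner_smul_right, inner_smul_right, mul_left_comm, Complex.re_ofReal_mul]
  have h := inner_mul_symm_re_eq_norm (𝕜 := ℂ) (b i) x
  rw [norm_mul, norm_inner_symm x (b i), ← sq] at h
  exact congrArg _ h

/-- Weyl's inequality for eigenvalue counting functions. -/
lemma card_filter_le_le_card_filter_le_add
    (b c : OrthonormalBasis ι ℂ E) {S T : E →L[ℂ] E} {f g : ι → ℝ}
    (hb : ∀ i, S (b i) = (f i : ℂ) • b i) (hc : ∀ i, T (c i) = (g i : ℂ) • c i)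
    {v : ℝ} (hv : ‖T - S‖ ≤ v) (t : ℝ) :
    (Finset.univ.filter (fun i => f i ≤ t)).card ≤
      (Finset.univ.filter (fun i => g i ≤ t + v)).card := by
  by_contra! hlt
  have : FiniteDimensional ℂ E := b.toBasis.finiteDimensional_of_finite
  let L : E →ₗ[ℂ] ({i // ¬ f i ≤ t} ⊕ {i // g i ≤ t + v}) → ℂ :=
    LinearMap.pi (Sum.elim (fun i => (innerSL ℂ (b i)).toLinearMap)
      (fun i => (innerSL ℂ (c i)).toLinearMap))
  have hdim : Module.finrank ℂ (({i // ¬ f i ≤ t} ⊕ {i // g i ≤ t + v}) → ℂ) <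
      Module.finrank ℂ E := by
    have hcompl := Finset.card_filter_add_card_filter_not (s := Finset.univ) (fun i => f i ≤ t)
    rw [Module.finrank_fintype_fun_eq_card, Fintype.card_sum, Fintype.card_subtype,
      Fintype.card_subtype, Module.finrank_eq_card_basis b.toBasis, ← Finset.card_univ]
    omega
  obtain ⟨x, hxL, hx⟩ :=
    (Submodule.ne_bot_iff _).1 (LinearMap.ker_ne_bot_of_finrank_lt hdim (f := L))
  have hxb : ∀ i, ¬ f i ≤ t → inner ℂ (b i) x = 0 := fun i hi =>
    congrFun (LinearMap.mem_ker.1 hxL) (Sum.inl ⟨i, hi⟩)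
  have hxc : ∀ i, g i ≤ t + v → inner ℂ (c i) x = 0 := fun i hi =>
    congrFun (LinearMap.mem_ker.1 hxL) (Sum.inr ⟨i, hi⟩)
  have hS : (inner ℂ x (S x)).re ≤ t * ‖x‖ ^ 2 := by
    rw [b.re_inner_apply_eq_sum hb, ← b.sum_sq_norm_inner_right x, Finset.mul_sum]
    refine Finset.sum_le_sum fun i _ => ?_
    by_cases hi : f i ≤ t
    · gcongr
    · simp [hxb i hi]
  have hT : (t + v) * ‖x‖ ^ 2 < (inner ℂ x (T x)).re := by
    rw [c.re_inner_apply_eq_sum hc, ← c.sum_sq_norm_inner_right x, Finset.mul_sum]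
    obtain ⟨j, hj⟩ : ∃ j, inner ℂ (c j) x ≠ 0 := by
      by_contra! h
      exact hx (by rw [← c.sum_repr' x]; simp [h])
    refine Finset.sum_lt_sum (fun i _ => ?_) ⟨j, Finset.mem_univ _, ?_⟩
    · by_cases hi : g i ≤ t + v
      · simp [hxc i hi]
      · gcongr
        exact (not_le.1 hi).le
    · have : t + v < g j := not_le.1 fun h => hj (hxc j h)
      gcongr
  have hdiff : (inner ℂ x (T x)).re - (inner ℂ x (S x)).re ≤ v * ‖x‖ ^ 2 := by
    rw [← Complex.sub_re, ← inner_sub_right, ← _root_.sub_apply]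
    calc (inner ℂ x ((T - S) x)).re ≤ ‖x‖ * ‖(T - S) x‖ := re_inner_le_norm (𝕜 := ℂ) _ _
      _ ≤ ‖x‖ * (v * ‖x‖) := by gcongr; exact (T - S).le_of_opNorm_le hv x
      _ = v * ‖x‖ ^ 2 := by ring
  linarith

lemma exists_phase_norm_sub_sq_eq {φ ψ : E} (hφ : ‖φ‖ = 1) (hψ : ‖ψ‖ = 1) :
    ∃ θ ∈ Set.Ico 0 (2 * Real.pi),
      ‖ψ - Complex.exp (θ * Complex.I) • φ‖ ^ 2 = 2 - 2 * ‖inner ℂ φ ψ‖ := by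
  set z := inner ℂ φ ψ with hz
  refine ⟨toIcoMod Real.two_pi_pos 0 z.arg, by simpa using toIcoMod_mem_Ico Real.two_pi_pos 0 z.arg,
    ?_⟩
  have hexp : Complex.exp ((toIcoMod Real.two_pi_pos 0 z.arg : ℝ) * Complex.I) =
      Complex.exp (z.arg * Complex.I) := by
    rw [toIcoMod]
    push_cast
    rw [Complex.exp_eq_exp_iff_exists_int]
    refine ⟨-toIcoDiv Real.two_pi_pos 0 z.arg, ?_⟩
    simp only [zsmul_eq_mul]
    push_cast
    ring
  have hre : (inner ℂ ψ (Complex.exp (z.arg * Complex.I) • φ)).re = ‖z‖ := by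
    rw [inner_smul_right, ← inner_conj_symm ψ φ, ← hz]
    nth_rw 2 [← Complex.norm_mul_exp_arg_mul_I z]
    rw [map_mul, Complex.conj_ofReal, mul_left_comm, Complex.mul_conj, Complex.normSq_eq_norm_sq,
      Complex.norm_exp_ofReal_mul_I]
    simp
  rw [hexp, @norm_sub_sq ℂ, norm_smul, Complex.norm_exp_ofReal_mul_I, hφ, hψ]
  change 1 ^ 2 - 2 * (inner ℂ ψ (Complex.exp (z.arg * Complex.I) • φ)).re + _ = _
  rw [hre]
  ring

/-- A quantitative `sin Θ` bound for a unit vector that is nearly an eigenvector. -/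
lemma OrthonormalBasis.one_sub_sq_norm_inner_mul_sq_le [DecidableEq ι]
    (b : OrthonormalBasis ι ℂ E) {T : E →L[ℂ] E}
    {f : ι → ℝ} (hb : ∀ i, T (b i) = (f i : ℂ) • b i) {i₀ : ι} {e' δ : ℝ} (hδ : 0 ≤ δ)
    (hgap : ∀ i ≠ i₀, δ ≤ |f i - e'|) {ψ : E} (hψ : ‖ψ‖ = 1) :
    (1 - ‖inner ℂ (b i₀) ψ‖ ^ 2) * δ ^ 2 ≤ ‖T ψ - (e' : ℂ) • ψ‖ ^ 2 := by
  have hcoord : ∀ i, inner ℂ (b i) (T ψ - (e' : ℂ) • ψ) =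
      ((f i - e' : ℝ) : ℂ) * inner ℂ (b i) ψ := by
    intro i
    have hTψ : T ψ = ∑ j, inner ℂ (b j) ψ • (f j : ℂ) • b j := by
      conv_lhs => rw [← b.sum_repr' ψ]
      simp [map_sum, hb]
    rw [inner_sub_right, hTψ, inner_sum]
    simp only [inner_smul_right, b.inner_eq_ite, mul_ite, mul_one, mul_zero,
      Finset.sum_ite_eq, Finset.mem_univ, if_true]
    push_cast
    ring
  have hsum := b.sum_sq_norm_inner_right ψ
  rw [← Finset.add_sum_erase _ _ (Finset.mem_univ i₀), hψ] at hsum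
  have hrest : 1 - ‖inner ℂ (b i₀) ψ‖ ^ 2 = ∑ i ∈ Finset.univ.erase i₀, ‖inner ℂ (b i) ψ‖ ^ 2 := by
    linarith
  rw [hrest, ← b.sum_sq_norm_inner_right (T ψ - (e' : ℂ) • ψ), Finset.sum_mul]
  refine (Finset.sum_le_sum fun i hi => ?_).trans
    (Finset.sum_le_sum_of_subset_of_nonneg (Finset.erase_subset i₀ _) fun _ _ _ => by positivity)
  rw [hcoord, norm_mul, Complex.norm_real, Real.norm_eq_abs, mul_pow, mul_comm]
  gcongr
  exact hgap i (Finset.ne_of_mem_erase hi)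

end InnerProductSpace

lemma Matrix.IsHermitian.toEuclideanCLM_eigenvectorBasis {n : Type*} [Fintype n] [DecidableEq n]
    {A : Matrix n n ℂ} (hA : A.IsHermitian) (i : n) :
    toEuclideanCLM (𝕜 := ℂ) A (hA.eigenvectorBasis i) =
      (hA.eigenvalues i : ℂ) • hA.eigenvectorBasis i := by
  apply WithLp.ofLp_injective
  rw [ofLp_toEuclideanCLM, hA.mulVec_eigenvectorBasis]
  rfl

/-- Eigenvector perturbation bound for Hermitian matrices: if the k-th smallest
eigenvalue of `H₀` is simple and separated from the rest of the spectrum by a gap `Δ`, and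
`‖V‖ ≤ Δ/3`, then the k-th smallest eigenvalue of `H₀ + V` is simple, and any unit eigenvector
`ψ` of `H₀ + V` for it is within `3‖V‖/Δ` of `e^{iθ} φ` for some phase `θ`. -/
theorem stmt_0 {N : ℕ} (hN : 1 ≤ N) (H₀ V : Matrix (Fin N) (Fin N) ℂ)
    (hH : H₀.IsHermitian) (hV : V.IsHermitian)
    (k : Fin N) (Δ : ℝ) (hΔ : 0 < Δ)
    (hsimple : ∃! i, hH.eigenvalues i = kthSmallest hH.eigenvalues k)
    (hgap : ∀ i, hH.eigenvalues i ≠ kthSmallest hH.eigenvalues k →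
      Δ ≤ |hH.eigenvalues i - kthSmallest hH.eigenvalues k|)
    (φ : Fin N → ℂ) (hφ : euclNorm φ = 1)
    (hφeig : H₀.mulVec φ = (kthSmallest hH.eigenvalues k : ℂ) • φ)
    (hVnorm : specNorm V ≤ Δ / 3) :
    (∃! i, (hH.add hV).eigenvalues i = kthSmallest (hH.add hV).eigenvalues k) ∧
    ∀ ψ : Fin N → ℂ, euclNorm ψ = 1 →
      (H₀ + V).mulVec ψ = (kthSmallest (hH.add hV).eigenvalues k : ℂ) • ψ →
      ∃ θ : ℝ, θ ∈ Set.Ico 0 (2 * Real.pi) ∧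
        euclNorm (ψ - Complex.exp (θ * Complex.I) • φ) ≤ 3 * specNorm V / Δ := by
  set f := hH.eigenvalues
  set g := (hH.add hV).eigenvalues
  set S := toEuclideanCLM (𝕜 := ℂ) H₀ with hS
  set T := toEuclideanCLM (𝕜 := ℂ) (H₀ + V) with hT
  set b := hH.eigenvectorBasis
  have hb : ∀ i, S (b i) = (f i : ℂ) • b i := hH.toEuclideanCLM_eigenvectorBasis
  have hc := (hH.add hV).toEuclideanCLM_eigenvectorBasis
  have hTS : T - S = toEuclideanCLM (𝕜 := ℂ) V := by rw [hT, hS, map_add]; abel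
  have hv0 : 0 ≤ specNorm V := norm_nonneg _
  have hfg := card_filter_le_le_card_filter_le_add b _ hb hc (v := specNorm V)
    (by rw [hTS]; rfl)
  have hgf := card_filter_le_le_card_filter_le_add _ b hc hb (v := specNorm V)
    (by rw [norm_sub_rev, hTS]; rfl)
  have hk : (k : ℕ) < Fintype.card (Fin N) := by simp
  refine ⟨existsUnique_eq_kthSmallest hΔ hVnorm hfg hgf hk hsimple hgap, fun ψ hψ hψeig => ?_⟩
  have hle := kthSmallest_le_add hfg hk
  have hge := kthSmallest_le_add hgf hk
  set e := kthSmallest f k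
  set e' := kthSmallest g k
  set v := specNorm V
  obtain ⟨i₀, hi₀, huniq⟩ := hsimple
  set φE : EuclideanSpace ℂ (Fin N) := WithLp.toLp 2 φ with hφE
  set ψE : EuclideanSpace ℂ (Fin N) := WithLp.toLp 2 ψ with hψE
  have hφ1 : ‖φE‖ = 1 := hφ
  have hψ1 : ‖ψE‖ = 1 := hψ
  have hSφ : S φE = (e : ℂ) • φE := by
    rw [hS, hφE, toEuclideanCLM_toLp, hφeig, WithLp.toLp_smul]
  have hTψ : T ψE = (e' : ℂ) • ψE := by
    rw [hT, hψE, toEuclideanCLM_toLp, hψeig, WithLp.toLp_smul]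
  have hgap' : ∀ i ≠ i₀, Δ ≤ |f i - e| := fun i hi => hgap i fun h => hi (huniq i h)
  have hφ_coord : ‖inner ℂ (b i₀) φE‖ = 1 := by
    have h := b.one_sub_sq_norm_inner_mul_sq_le hb hΔ.le hgap' hφ1
    rw [hSφ, sub_self, norm_zero] at h
    have hle1 : ‖inner ℂ (b i₀) φE‖ ≤ 1 := by
      simpa [hφ1] using norm_inner_le_norm (𝕜 := ℂ) (b i₀) φE
    have : 1 - ‖inner ℂ (b i₀) φE‖ ^ 2 ≤ 0 := by
      by_contra! hpos
      have : 0 < (1 - ‖inner ℂ (b i₀) φE‖ ^ 2) * Δ ^ 2 := by positivity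
      linarith
    nlinarith [norm_nonneg (inner ℂ (b i₀) φE)]
  have hφb : φE = inner ℂ (b i₀) φE • b i₀ := by
    have hsq := @norm_sub_sq ℂ _ _ _ _ φE (inner ℂ (b i₀) φE • b i₀)
    rw [inner_smul_right, inner_mul_symm_re_eq_norm, norm_mul, norm_inner_symm φE, norm_smul,
      hφ_coord, hφ1, b.norm_eq_one] at hsq
    rw [← sub_eq_zero, ← norm_eq_zero, ← sq_eq_zero_iff, hsq]
    norm_num
  have hinner : ‖inner ℂ φE ψE‖ = ‖inner ℂ (b i₀) ψE‖ := by
    conv_lhs => rw [hφb, inner_smul_left, norm_mul, RCLike.norm_conj, hφ_coord, one_mul]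
  have hdefect : ‖S ψE - (e' : ℂ) • ψE‖ ≤ v := by
    rw [← hTψ, norm_sub_rev, ← _root_.sub_apply, hTS]
    exact ((toEuclideanCLM (𝕜 := ℂ) V).le_opNorm ψE).trans_eq (by rw [hψ1, mul_one]; rfl)
  have hsin : (1 - ‖inner ℂ (b i₀) ψE‖ ^ 2) * (2 * Δ / 3) ^ 2 ≤ v ^ 2 := by
    refine (b.one_sub_sq_norm_inner_mul_sq_le hb (e' := e') (by positivity) (fun i hi => ?_)
      hψ1).trans (by gcongr)
    rcases le_abs.1 (hgap' i hi) with h | h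
    · exact le_abs.2 (Or.inl (by linarith))
    · exact le_abs.2 (Or.inr (by linarith))
  obtain ⟨θ, hθ, hnorm⟩ := exists_phase_norm_sub_sq_eq hφ1 hψ1
  refine ⟨θ, hθ, ?_⟩
  change ‖ψE - Complex.exp (θ * Complex.I) • φE‖ ≤ 3 * v / Δ
  refine le_of_sq_le_sq ?_ (by positivity)
  rw [hnorm, hinner, div_pow, le_div_iff₀ (by positivity)]
  have hle1 : ‖inner ℂ (b i₀) ψE‖ ≤ 1 := by
    simpa [hψ1] using norm_inner_le_norm (𝕜 := ℂ) (b i₀) ψE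
  have hcmp : 1 - ‖inner ℂ (b i₀) ψE‖ ≤ 1 - ‖inner ℂ (b i₀) ψE‖ ^ 2 := by
    nlinarith [norm_nonneg (inner ℂ (b i₀) ψE)]
  nlinarith [mul_le_mul_of_nonneg_right hcmp (sq_nonneg Δ), sq_nonneg v]
end

section
/- For every n ≥ 1 there exist constants ν₀ > 0, r > 0 and C > 0, depending only on n, with the following property. Let λ = (λ_a)_{a ≠ 0ⁿ} ∈ ℝ^{4ⁿ−1} satisfy |λ_a| ≤ 1 for all a, let ν ≥ ν₀, and set E* = E(λ, ν) ∈ ℝ^{n·6ⁿ}. Then there exists a C^∞ map g : B_r(E*) → ℝ^{4ⁿ−1} such that g(E*) = λ, such that for every Ê ∈ B_r(E*) the function μ ↦ L(Ê, μ, ν) is differentiable at g(Ê) with vanishing gradient, i.e., ∂L/∂μ(Ê, g(Ê), ν) = 0, and such that ‖g(Ê) − λ‖ ≤ C‖Ê − E*‖ for all Ê ∈ B_r(E*). -/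
open Matrix

/-- The Pauli matrices. -/
noncomputable def pauli : Fin 4 → Matrix (Fin 2) (Fin 2) ℂ
  | 0 => 1
  | 1 => !![0, 1; 1, 0]
  | 2 => !![0, -Complex.I; Complex.I, 0]
  | 3 => !![1, 0; 0, -1]

/-- The Pauli string σ^a on n qubits. -/
noncomputable def pauliString {n : ℕ} (a : Fin n → Fin 4) :
    Matrix (Fin n → Fin 2) (Fin n → Fin 2) ℂ :=
  fun x y => ∏ j, pauli (a j) (x j) (y j)

/-- Index set for nontrivial Pauli strings. -/
abbrev PIdx (n : ℕ) := {a : Fin n → Fin 4 // a ≠ fun _ => 0}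

/-- The unknown Hamiltonian H(μ). -/
noncomputable def Hmat {n : ℕ} (lam : PIdx n → ℝ) :
    Matrix (Fin n → Fin 2) (Fin n → Fin 2) ℂ :=
  ∑ a : PIdx n, (lam a : ℂ) • pauliString a.val

/-- σ^(β+1) acting on the j-th qubit. -/
noncomputable def pauliAt {n : ℕ} (j : Fin n) (b : Fin 3) :
    Matrix (Fin n → Fin 2) (Fin n → Fin 2) ℂ :=
  pauliString (fun i => if i = j then b.succ else 0)

/-- The control Hamiltonian. -/
noncomputable def Hctrl {n : ℕ} (k : Fin n) (s : Fin n → Fin 2) (β : Fin n → Fin 3) :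
    Matrix (Fin n → Fin 2) (Fin n → Fin 2) ℂ :=
  (∑ j ∈ Finset.univ.erase k, ((-1 : ℂ) ^ (s j : ℕ)) • pauliAt j (β j))
    + (((-1 : ℂ) ^ (s k : ℕ)) / 2) • pauliAt k (β k)

/-- The total Hamiltonian. -/
noncomputable def Htot {n : ℕ} (lam : PIdx n → ℝ) (ν : ℝ) (k : Fin n) (s : Fin n → Fin 2)
    (β : Fin n → Fin 3) : Matrix (Fin n → Fin 2) (Fin n → Fin 2) ℂ :=
  Hmat lam - (ν : ℂ) • Hctrl k s β

open Classical in
/-- The gap between the two smallest eigenvalues of H_tot. -/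
noncomputable def Egap {n : ℕ} (lam : PIdx n → ℝ) (ν : ℝ) (k : Fin n) (s : Fin n → Fin 2)
    (β : Fin n → Fin 3) : ℝ :=
  if h : (Htot lam ν k s β).IsHermitian then
    kthSmallest h.eigenvalues 1 - kthSmallest h.eigenvalues 0
  else 0

abbrev EIdx (n : ℕ) := Fin n × (Fin n → Fin 2) × (Fin n → Fin 3)

/-- The vector of all gaps, in ℝ^{n·6^n}. -/
noncomputable def EvecE {n : ℕ} (μ : EuclideanSpace ℝ (PIdx n)) (ν : ℝ) :
    EuclideanSpace ℝ (EIdx n) :=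
  (WithLp.equiv 2 _).symm (fun p => Egap ((WithLp.equiv 2 _) μ) ν p.1 p.2.1 p.2.2)

/-- The least-squares loss. -/
noncomputable def Lloss {n : ℕ} (Ehat : EuclideanSpace ℝ (EIdx n))
    (μ : EuclideanSpace ℝ (PIdx n)) (ν : ℝ) : ℝ :=
  (1 / 2) * ‖Ehat - EvecE μ ν‖ ^ 2

open scoped Topology ContDiff

theorem kthSmallest_of_two_smallest {ι : Type*} [Fintype ι] (f : ι → ℝ) {i₀ i₁ : ι}
    (hne : i₀ ≠ i₁) (h₀₁ : f i₀ ≤ f i₁) (h : ∀ i, i ≠ i₀ → i ≠ i₁ → f i₁ ≤ f i) :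
    kthSmallest f 0 = f i₀ ∧ kthSmallest f 1 = f i₁ := by
  classical
  have huniv : (Finset.univ : Finset ι).val =
      i₀ ::ₘ i₁ ::ₘ ((Finset.univ.erase i₀).erase i₁).val := by
    rw [← Finset.insert_val_of_notMem (Finset.notMem_erase _ _),
      Finset.insert_erase (by simp [hne.symm]), ← Finset.insert_val_of_notMem (Finset.notMem_erase _ _),
      Finset.insert_erase (by simp)]
  have hsort : (Finset.univ.val.map f).sort (· ≤ ·) =
      f i₀ :: f i₁ :: (((Finset.univ.erase i₀).erase i₁).val.map f).sort (· ≤ ·) := by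
    rw [huniv, Multiset.map_cons, Multiset.map_cons, Multiset.sort_cons, Multiset.sort_cons]
    · simp only [Multiset.mem_map, Finset.mem_val, Finset.mem_erase]
      rintro _ ⟨i, hi, rfl⟩
      exact h i hi.2.1 hi.1
    · simp only [Multiset.mem_cons, Multiset.mem_map, Finset.mem_val, Finset.mem_erase]
      rintro _ (rfl | ⟨i, hi, rfl⟩)
      · exact h₀₁
      · exact h₀₁.trans (h i hi.2.1 hi.1)
  simp [kthSmallest, hsort]

section Hermitian

variable {ι : Type*} [Fintype ι] {A : Matrix ι ι ℂ}

theorem star_dotProduct_eq_zero_of_eigenvalue_ne (hA : A.IsHermitian) {u w : ι → ℂ} {a : ℂ} {c : ℝ}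
    (hu : A *ᵥ u = a • u) (hw : A *ᵥ w = (c : ℂ) • w) (hac : a ≠ c) : star u ⬝ᵥ w = 0 := by
  have h1 : star w ⬝ᵥ (A *ᵥ u) = a * (star w ⬝ᵥ u) := by rw [hu, dotProduct_smul, smul_eq_mul]
  have h2 : star w ⬝ᵥ (A *ᵥ u) = c * (star w ⬝ᵥ u) := by
    rw [dotProduct_mulVec, ← hA.eq, ← star_mulVec, hw, star_smul, smul_dotProduct]
    simp
  have h3 : star w ⬝ᵥ u = 0 := by
    have : (a - c) * (star w ⬝ᵥ u) = 0 := by rw [sub_mul, ← h1, ← h2, sub_self]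
    exact (mul_eq_zero.1 this).resolve_left (sub_ne_zero.2 hac)
  rw [star_dotProduct, h3, star_zero]

variable [DecidableEq ι]

theorem exists_eigenvalue_eq (hA : A.IsHermitian) {v : ι → ℂ} {a : ℂ} (hv : v ≠ 0)
    (hAv : A *ᵥ v = a • v) :
    ∃ i, a = hA.eigenvalues i ∧ star v ⬝ᵥ ⇑(hA.eigenvectorBasis i) ≠ 0 := by
  have hex : ∃ i, star v ⬝ᵥ ⇑(hA.eigenvectorBasis i) ≠ 0 := by
    by_contra! hcon
    apply hv
    have : (WithLp.toLp 2 v : EuclideanSpace ℂ ι) = 0 := by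
      refine InnerProductSpace.ext_inner_right_basis hA.eigenvectorBasis.toBasis
        fun i => ?_
      rw [inner_zero_left, EuclideanSpace.inner_eq_star_dotProduct, dotProduct_comm]
      simpa using hcon i
    simpa using congrArg WithLp.ofLp this
  obtain ⟨i, hi⟩ := hex
  refine ⟨i, ?_, hi⟩
  by_contra hne
  refine hi (star_dotProduct_eq_zero_of_eigenvalue_ne hA hAv ?_ hne)
  simpa using hA.mulVec_eigenvectorBasis i

/-- If the only eigenvector of `A` orthogonal to `v` with eigenvalue `c` is zero, then `c` occurs
at most once among the eigenvalues of `A`. -/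
theorem eigenvalues_ne_of_forall_orthogonal (hA : A.IsHermitian) {v : ι → ℂ} {i₀ i : ι}
    (hi : i ≠ i₀) (hv : star v ⬝ᵥ ⇑(hA.eigenvectorBasis i₀) ≠ 0)
    (h : ∀ w : ι → ℂ, A *ᵥ w = (hA.eigenvalues i₀ : ℂ) • w → star v ⬝ᵥ w = 0 → w = 0) :
    hA.eigenvalues i ≠ hA.eigenvalues i₀ := by
  intro heq
  set b := hA.eigenvectorBasis with hb
  have hbA : ∀ j, A *ᵥ ⇑(b j) = (hA.eigenvalues j : ℂ) • ⇑(b j) := fun j => by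
    simpa using hA.mulVec_eigenvectorBasis j
  have hw := h ((star v ⬝ᵥ ⇑(b i₀)) • ⇑(b i) - (star v ⬝ᵥ ⇑(b i)) • ⇑(b i₀))
    (by rw [mulVec_sub, mulVec_smul, mulVec_smul, hbA, hbA, heq, smul_sub, smul_comm _ (_ : ℂ),
          smul_comm _ (_ : ℂ) ⇑(b i₀)])
    (by simp only [dotProduct_sub, dotProduct_smul, smul_eq_mul]; ring)
  have hw' : (star v ⬝ᵥ ⇑(b i₀)) • b i - (star v ⬝ᵥ ⇑(b i)) • b i₀ = 0 := by
    ext j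
    simpa using congrFun hw j
  have := congrArg (fun z => inner ℂ (b i) z) hw'
  simp only [inner_sub_right, inner_smul_right, b.inner_eq_ite, inner_zero_right] at this
  exact hv (by simpa [hi] using this)

/-- Two eigenvectors whose common orthogonal complement contains no eigenvector of comparable or
smaller eigenvalue carry the two smallest eigenvalues. -/
theorem kthSmallest_eigenvalues (hA : A.IsHermitian) {v₀ v₁ : ι → ℂ} {a₀ a₁ : ℂ}
    (hv₀ : v₀ ≠ 0) (hv₁ : v₁ ≠ 0) (h₀ : A *ᵥ v₀ = a₀ • v₀) (h₁ : A *ᵥ v₁ = a₁ • v₁)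
    (hlt : a₀.re < a₁.re)
    (h : ∀ c : ℝ, c ≤ a₁.re → ∀ w : ι → ℂ, A *ᵥ w = (c : ℂ) • w → star v₀ ⬝ᵥ w = 0 →
      star v₁ ⬝ᵥ w = 0 → w = 0) :
    kthSmallest hA.eigenvalues 0 = a₀.re ∧ kthSmallest hA.eigenvalues 1 = a₁.re := by
  obtain ⟨i₀, rfl, hi₀⟩ := exists_eigenvalue_eq hA hv₀ h₀
  obtain ⟨i₁, rfl, hi₁⟩ := exists_eigenvalue_eq hA hv₁ h₁
  simp only [Complex.ofReal_re] at hlt h ⊢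
  refine kthSmallest_of_two_smallest _ (by rintro rfl; exact lt_irrefl _ hlt) hlt.le ?_
  intro i hii₀ hii₁
  by_contra! hi
  have hbA : A *ᵥ ⇑(hA.eigenvectorBasis i) = (hA.eigenvalues i : ℂ) • ⇑(hA.eigenvectorBasis i) := by
    simpa using hA.mulVec_eigenvectorBasis i
  have hne₀ : hA.eigenvalues i ≠ hA.eigenvalues i₀ := by
    refine eigenvalues_ne_of_forall_orthogonal hA hii₀ hi₀ fun w hw hvw => ?_
    refine h _ hlt.le w hw hvw (star_dotProduct_eq_zero_of_eigenvalue_ne hA h₁ hw ?_)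
    exact_mod_cast hlt.ne'
  have hbi := h _ hi.le _ hbA
    (star_dotProduct_eq_zero_of_eigenvalue_ne hA h₀ hbA (by exact_mod_cast hne₀.symm))
    (star_dotProduct_eq_zero_of_eigenvalue_ne hA h₁ hbA (by exact_mod_cast hi.ne'))
  refine hA.eigenvectorBasis.orthonormal.ne_zero i ?_
  ext j
  simpa using congrFun hbi j

end Hermitian

section DiagonalPerturbation

variable {ι : Type*} [Fintype ι] [DecidableEq ι]

/-- An eigenvector of a small perturbation of a diagonal matrix that is orthogonal to vectors close
to the two lowest basis vectors has a large eigenvalue. -/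
theorem eq_zero_of_perturbed_diagonal {d : ι → ℝ} {M : Matrix ι ι ℂ} {i₀ i₁ : ι} {t γ : ℝ}
    (hd : ∀ j, j ≠ i₀ → j ≠ i₁ → t + γ ≤ d j)
    (hM : ∀ j, ∑ k, ‖M j k‖ < γ) {v₀ v₁ : ι → ℂ} (h₀ : v₀ i₀ = 1) (h₁ : v₁ i₁ = 1)
    (hv₀ : ∑ k ∈ Finset.univ.erase i₀, ‖v₀ k‖ < 1)
    (hv₁ : ∑ k ∈ Finset.univ.erase i₁, ‖v₁ k‖ < 1)
    {c : ℝ} (hc : c ≤ t) {w : ι → ℂ}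
    (hw : (diagonal (fun j => (d j : ℂ)) + M) *ᵥ w = (c : ℂ) • w)
    (hw₀ : star v₀ ⬝ᵥ w = 0) (hw₁ : star v₁ ⬝ᵥ w = 0) : w = 0 := by
  by_contra hne
  have hpos : 0 < ‖w‖ := norm_pos_iff.2 hne
  have : Nonempty ι := ⟨i₀⟩
  obtain ⟨j, hj⟩ : ∃ j, ‖w j‖ = ‖w‖ := by
    obtain ⟨j, -, hj⟩ := Finset.exists_max_image Finset.univ (fun j => ‖w j‖) Finset.univ_nonempty
    exact ⟨j, le_antisymm (norm_le_pi_norm _ _)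
      ((pi_norm_le_iff_of_nonneg (norm_nonneg _)).2 fun k => hj k (Finset.mem_univ k))⟩
  have hsmall : ∀ (v : ι → ℂ) (i : ι), v i = 1 → ∑ k ∈ Finset.univ.erase i, ‖v k‖ < 1 →
      star v ⬝ᵥ w = 0 → ‖w i‖ < ‖w‖ := by
    intro v i hvi hv hvw
    rw [dotProduct, ← Finset.add_sum_erase _ _ (Finset.mem_univ i)] at hvw
    simp only [Pi.star_apply, hvi, star_one, one_mul] at hvw
    rw [eq_neg_of_add_eq_zero_left hvw, norm_neg]
    calc _ ≤ ∑ k ∈ Finset.univ.erase i, ‖v k‖ * ‖w‖ := by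
          refine norm_sum_le_of_le _ fun k _ => ?_
          rw [norm_mul, norm_star]
          gcongr
          exact norm_le_pi_norm _ _
      _ = (∑ k ∈ Finset.univ.erase i, ‖v k‖) * ‖w‖ := by rw [Finset.sum_mul]
      _ < ‖w‖ := by nlinarith
  have hj₀ : j ≠ i₀ := by rintro rfl; exact (hsmall v₀ j h₀ hv₀ hw₀).ne hj
  have hj₁ : j ≠ i₁ := by rintro rfl; exact (hsmall v₁ j h₁ hv₁ hw₁).ne hj
  have hrow := congrFun hw j
  rw [add_mulVec, Pi.add_apply, mulVec_diagonal, Pi.smul_apply, smul_eq_mul] at hrow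
  have hMw : (M *ᵥ w) j = ((c - d j : ℝ) : ℂ) * w j := by
    push_cast
    linear_combination hrow
  have h1 : ‖(M *ᵥ w) j‖ ≤ (∑ k, ‖M j k‖) * ‖w‖ := by
    rw [Finset.sum_mul]
    refine norm_sum_le_of_le _ fun k _ => ?_
    rw [norm_mul]
    gcongr
    exact norm_le_pi_norm _ _
  rw [hMw, norm_mul, Complex.norm_real, hj] at h1
  have h2 : γ ≤ ‖c - d j‖ := by
    rw [Real.norm_eq_abs, abs_sub_comm]
    exact le_trans (by linarith [hd j hj₀ hj₁]) (le_abs_self _)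
  nlinarith [hM j]

end DiagonalPerturbation

section EigenvalueBranch

theorem isInvertible_of_injective {V W : Type*} [NormedAddCommGroup V] [NormedSpace ℝ V]
    [FiniteDimensional ℝ V] [NormedAddCommGroup W] [NormedSpace ℝ W] [FiniteDimensional ℝ W]
    {T : V →L[ℝ] W} (hT : Function.Injective T)
    (hfr : Module.finrank ℝ V = Module.finrank ℝ W) : T.IsInvertible :=
  ⟨(LinearEquiv.ofInjectiveOfFinrankEq T.toLinearMap hT hfr).toContinuousLinearEquiv, by
    ext v; rfl⟩

variable {ι : Type*} [Fintype ι] [DecidableEq ι]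
  {E : Type*} [NormedAddCommGroup E] [NormedSpace ℝ E]

/-- A simple eigenvalue of a diagonal matrix persists, analytically, under a linear perturbation,
and its first-order variation is the corresponding diagonal entry of the perturbation. -/
theorem exists_eigenvalue_branch [CompleteSpace E] (d : ι → ℝ) {i : ι} (hd : ∀ j, j ≠ i → d j ≠ d i)
    (X : ι → ι → E →L[ℝ] ℂ) :
    ∃ (ℓ : E → ℂ) (v : E → ι → ℂ), ContDiffAt ℝ ω ℓ 0 ∧ ℓ 0 = d i ∧ HasFDerivAt ℓ (X i i) 0 ∧
      ContinuousAt v 0 ∧ v 0 = Pi.single i 1 ∧ (∀ x, v x i = 1) ∧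
      ∀ᶠ x in 𝓝 0, (diagonal (fun j => (d j : ℂ)) + of fun j k => X j k x) *ᵥ v x = ℓ x • v x := by
  set V : (ι → ℂ) → ι → ℂ := fun u j => if j = i then 1 else u j with hV
  set Φ : E × (ι → ℂ) → (ι → ℂ) :=
    fun p j => (d j - p.2 i) * V p.2 j + ∑ k, X j k p.1 * V p.2 k with hΦ
  set u₀ : ι → ℂ := Pi.single i (d i : ℂ) with hu₀
  have hu₀i : u₀ i = d i := by simp [hu₀]
  have hVu₀ : V u₀ = Pi.single i 1 := by
    ext j
    by_cases hj : j = i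
    · subst hj; simp [hV]
    · simp [hV, hu₀, hj]
  have hVc : ContDiff ℝ ω V := by
    refine contDiff_pi.2 fun j => ?_
    by_cases hj : j = i
    · simp only [hV, hj, if_true]; exact contDiff_const
    · simp only [hV, hj, if_false]; exact contDiff_apply ℝ ℂ j
  have hVj : ∀ j, ContDiff ℝ ω fun p : E × (ι → ℂ) => V p.2 j := fun j =>
    (contDiff_apply ℝ ℂ j).comp (hVc.comp contDiff_snd)
  have hui : ContDiff ℝ ω fun p : E × (ι → ℂ) => p.2 i := (contDiff_apply ℝ ℂ i).comp contDiff_snd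
  have hΦc : ContDiff ℝ ω Φ := by
    refine contDiff_pi.2 fun j => ((contDiff_const.sub hui).mul (hVj j)).add ?_
    exact ContDiff.sum fun k _ => ((X j k).contDiff.comp contDiff_fst).mul (hVj k)
  have hΦ0 : Φ (0, u₀) = 0 := by
    ext j
    by_cases hj : j = i
    · subst hj; simp [hΦ, hu₀i]
    · simp [hΦ, hVu₀, hj]
  have hder : ∀ w j, fderiv ℝ Φ (0, u₀) (0, w) j = if j = i then - w i else (d j - d i) * w j := by
    intro w j
    have h1 : HasFDerivAt (fun p : E × (ι → ℂ) => p.2 i)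
        ((ContinuousLinearMap.proj i : (ι → ℂ) →L[ℝ] ℂ) ∘L ContinuousLinearMap.snd ℝ E (ι → ℂ))
        (0, u₀) :=
      ((ContinuousLinearMap.proj i : (ι → ℂ) →L[ℝ] ℂ) ∘L
        ContinuousLinearMap.snd ℝ E (ι → ℂ)).hasFDerivAt
    have h2 : ∀ j, HasFDerivAt (fun p : E × (ι → ℂ) => V p.2 j)
        (if j = i then 0 else (ContinuousLinearMap.proj j : (ι → ℂ) →L[ℝ] ℂ) ∘L
          ContinuousLinearMap.snd ℝ E (ι → ℂ)) (0, u₀) := by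
      intro j
      by_cases hj : j = i
      · simp only [hV, hj, if_true]; exact hasFDerivAt_const _ _
      · simp only [hV, hj, if_false]
        exact ((ContinuousLinearMap.proj j : (ι → ℂ) →L[ℝ] ℂ) ∘L
          ContinuousLinearMap.snd ℝ E (ι → ℂ)).hasFDerivAt
    have h3 : ∀ k, HasFDerivAt (fun p : E × (ι → ℂ) => X j k p.1)
        (X j k ∘L ContinuousLinearMap.fst ℝ E (ι → ℂ)) (0, u₀) := fun k =>
      (X j k ∘L ContinuousLinearMap.fst ℝ E (ι → ℂ)).hasFDerivAt
    have h4 := ((h1.const_sub (d j : ℂ)).mul (h2 j)).add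
      (HasFDerivAt.fun_sum (u := Finset.univ) fun k _ => (h3 k).mul (h2 k))
    have h5 : HasFDerivAt (fun p => Φ p j) ((ContinuousLinearMap.proj j : (ι → ℂ) →L[ℝ] ℂ) ∘L
        fderiv ℝ Φ (0, u₀)) (0, u₀) :=
      (ContinuousLinearMap.proj j : (ι → ℂ) →L[ℝ] ℂ).hasFDerivAt.comp (0, u₀)
        (hΦc.differentiable (by simp) (0, u₀)).hasFDerivAt
    have h6 := congrArg (fun T : E × (ι → ℂ) →L[ℝ] ℂ => T (0, w)) (h5.unique h4)
    simp only [ContinuousLinearMap.comp_apply, ContinuousLinearMap.proj_apply] at h6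
    rw [h6]
    by_cases hj : j = i
    · subst hj
      simp only [hVu₀, Pi.single_apply]
      simp
      exact Finset.sum_eq_zero fun k _ => by split_ifs <;> simp
    · simp only [hVu₀, Pi.single_apply]
      simp [hj, hu₀i]
      exact Finset.sum_eq_zero fun k _ => by split_ifs <;> simp
  have hinv : (fderiv ℝ Φ (0, u₀) ∘L .inr ℝ E (ι → ℂ)).IsInvertible := by
    refine isInvertible_of_injective ?_ rfl
    rw [injective_iff_map_eq_zero]
    intro w hw
    ext j
    have hj := congrFun hw j
    rw [ContinuousLinearMap.comp_apply, ContinuousLinearMap.inr_apply, hder] at hj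
    by_cases hji : j = i
    · subst hji; simpa using hj
    · rw [if_neg hji] at hj
      have : (d j : ℂ) - d i ≠ 0 := sub_ne_zero.2 (by exact_mod_cast hd j hji)
      exact (mul_eq_zero.1 hj).resolve_left this
  set u := hΦc.contDiffAt.implicitFunction (by simp) hinv with hu
  have huc : ContDiffAt ℝ ω u 0 := hΦc.contDiffAt.contDiffAt_implicitFunction (by simp) hinv
  have hu0 : u 0 = u₀ := hΦc.contDiffAt.implicitFunction_apply_self (by simp) hinv
  have hueq : ∀ᶠ x in 𝓝 0, Φ (x, u x) = 0 := by
    filter_upwards [hΦc.contDiffAt.eventually_apply_implicitFunction (by simp) hinv] with x hx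
    exact hx.trans hΦ0
  have hvc : ContDiffAt ℝ ω (fun x => V (u x)) 0 := hVc.contDiffAt.comp 0 huc
  have hvj : ∀ j, ContDiffAt ℝ ω (fun x => V (u x) j) 0 := fun j => contDiffAt_pi.1 hvc j
  refine ⟨fun x => u x i, fun x => V (u x), contDiffAt_pi.1 huc i, by simp [hu0, hu₀i], ?_,
    hvc.continuousAt, by simp [hu0, hVu₀], fun x => by simp [hV], ?_⟩
  · have hℓ : (fun x => u x i) =ᶠ[𝓝 0] fun x => d i + ∑ k, X i k x * V (u x) k := by
      filter_upwards [hueq] with x hx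
      have := congrFun hx i
      simp only [hΦ, Pi.zero_apply] at this
      rw [show V (u x) i = 1 by simp [hV]] at this
      linear_combination -this
    refine HasFDerivAt.congr_of_eventuallyEq ?_ hℓ
    have h := (HasFDerivAt.fun_sum (u := Finset.univ) fun k _ =>
      ((X i k).hasFDerivAt (x := 0)).mul
        ((hvj k).differentiableAt (by simp)).hasFDerivAt).const_add (d i : ℂ)
    refine h.congr_fderiv ?_
    ext y
    simp only [hu0, hVu₀, Pi.single_apply]
    simp
    rw [Finset.sum_eq_single i] <;> simp +contextual
  · filter_upwards [hueq] with x hx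
    ext j
    have := congrFun hx j
    simp only [hΦ, Pi.zero_apply] at this
    rw [add_mulVec, Pi.add_apply, mulVec_diagonal, mulVec, dotProduct]
    simp only [of_apply, Pi.smul_apply, smul_eq_mul]
    linear_combination this

/-- Near a diagonal matrix with two simple lowest eigenvalues, the spectral gap of a Hermitian
linear perturbation is analytic, with first-order variation given by the diagonal entries. -/
theorem exists_gap_branch [CompleteSpace E] (d : ι → ℝ) {i₀ i₁ : ι} (h₀₁ : d i₀ < d i₁)
    (hd : ∀ j, j ≠ i₀ → j ≠ i₁ → d i₁ < d j) (X : ι → ι → E →L[ℝ] ℂ) :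
    ∃ f : E → ℝ, ContDiffAt ℝ ω f 0 ∧
      HasFDerivAt f (Complex.reCLM ∘L (X i₁ i₁ - X i₀ i₀)) 0 ∧
      ∀ᶠ x in 𝓝 0, ∀ ν : ℝ, 0 < ν → ∀ (U A : Matrix ι ι ℂ) (hA : A.IsHermitian),
        Uᴴ * U = 1 → U * Uᴴ = 1 →
        A = (ν : ℂ) • (U * (diagonal (fun j => (d j : ℂ)) + of fun j k => X j k x) * Uᴴ) →
        kthSmallest hA.eigenvalues 1 - kthSmallest hA.eigenvalues 0 = ν * f x := by
  obtain ⟨ℓ₀, v₀, hℓ₀, hℓ₀0, hℓ₀d, hv₀c, hv₀0, hv₀i, hv₀⟩ := exists_eigenvalue_branch d (i := i₀)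
    (fun j hj => by
      by_cases hj1 : j = i₁
      · rw [hj1]; exact h₀₁.ne'
      · exact (h₀₁.trans (hd j hj hj1)).ne') X
  obtain ⟨ℓ₁, v₁, hℓ₁, hℓ₁0, hℓ₁d, hv₁c, hv₁0, hv₁i, hv₁⟩ := exists_eigenvalue_branch d (i := i₁)
    (fun j hj => by
      by_cases hj0 : j = i₀
      · rw [hj0]; exact h₀₁.ne
      · exact (hd j hj0 hj).ne') X
  obtain ⟨γ, hγ, hdγ⟩ : ∃ γ > 0, ∀ j, j ≠ i₀ → j ≠ i₁ → d i₁ + γ + γ ≤ d j := by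
    have : ∀ᶠ γ in 𝓝[>] (0 : ℝ), ∀ j, j ≠ i₀ → j ≠ i₁ → d i₁ + γ + γ ≤ d j := by
      rw [Filter.eventually_all]
      intro j
      by_cases hj : j ≠ i₀ ∧ j ≠ i₁
      · have hlim : Filter.Tendsto (fun γ : ℝ => d i₁ + γ + γ) (𝓝[>] 0) (𝓝 (d i₁)) := by
          have : Continuous fun γ : ℝ => d i₁ + γ + γ := by fun_prop
          simpa using (this.tendsto 0).mono_left nhdsWithin_le_nhds
        filter_upwards [hlim.eventually (gt_mem_nhds (hd j hj.1 hj.2))] with γ hγ _ _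
        exact hγ.le
      · exact Filter.Eventually.of_forall fun γ h1 h2 => absurd ⟨h1, h2⟩ hj
    obtain ⟨γ, h1, h2⟩ := (this.and self_mem_nhdsWithin).exists
    exact ⟨γ, h2, h1⟩
  have hre : ∀ {ℓ : E → ℂ}, ContDiffAt ℝ ω ℓ 0 → ContDiffAt ℝ ω (fun x => (ℓ x).re) 0 :=
    fun h => Complex.reCLM.contDiff.contDiffAt.comp 0 h
  have hsum : ∀ {v : E → ι → ℂ} {i : ι}, ContinuousAt v 0 → v 0 = Pi.single i 1 →
      ∀ᶠ x in 𝓝 0, ∑ k ∈ Finset.univ.erase i, ‖v x k‖ < 1 := by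
    intro v i hc h0
    have hlim : ContinuousAt (fun x => ∑ k ∈ Finset.univ.erase i, ‖v x k‖) 0 :=
      tendsto_finsetSum _ fun k _ => (continuousAt_pi.1 hc k).norm
    refine hlim.eventually (gt_mem_nhds ?_)
    refine lt_of_eq_of_lt (Finset.sum_eq_zero fun k hk => ?_) one_pos
    simp [h0, Finset.ne_of_mem_erase hk]
  have hX : ∀ᶠ x in 𝓝 (0 : E), ∀ j, ∑ k, ‖X j k x‖ < γ := by
    rw [Filter.eventually_all]
    intro j
    have hlim : Continuous (fun x => ∑ k, ‖X j k x‖) := by fun_prop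
    exact hlim.continuousAt.eventually (gt_mem_nhds (by simpa using hγ))
  have hlt : ∀ᶠ x in 𝓝 (0 : E), (ℓ₀ x).re < (ℓ₁ x).re :=
    (hre hℓ₀).continuousAt.eventually_lt (hre hℓ₁).continuousAt (by simpa [hℓ₀0, hℓ₁0] using h₀₁)
  have hle : ∀ᶠ x in 𝓝 (0 : E), (ℓ₁ x).re < d i₁ + γ :=
    (hre hℓ₁).continuousAt.eventually (gt_mem_nhds (by simpa [hℓ₁0] using hγ))
  refine ⟨fun x => (ℓ₁ x).re - (ℓ₀ x).re, (hre hℓ₁).sub (hre hℓ₀), ?_, ?_⟩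
  · have := (Complex.reCLM.hasFDerivAt.comp 0 hℓ₁d).sub (Complex.reCLM.hasFDerivAt.comp 0 hℓ₀d)
    rw [ContinuousLinearMap.comp_sub]
    exact this
  filter_upwards [hv₀, hv₁, hsum hv₀c hv₀0, hsum hv₁c hv₁0, hX, hlt, hle]
    with x hv₀ hv₁ hs₀ hs₁ hX hlt hle ν hν U A hA hU hU' hAU
  set B := diagonal (fun j => (d j : ℂ)) + of fun j k => X j k x with hB
  have hUne : ∀ {v : ι → ℂ} {i : ι}, v i = 1 → U *ᵥ v ≠ 0 := by
    intro v i hvi h0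
    have : v = 0 := by rw [← one_mulVec v, ← hU, ← mulVec_mulVec, h0, mulVec_zero]
    simp [this] at hvi
  have hAv : ∀ {v : ι → ℂ} {a : ℂ}, B *ᵥ v = a • v → A *ᵥ (U *ᵥ v) = (ν * a) • (U *ᵥ v) := by
    intro v a hv
    rw [hAU, smul_mulVec, mulVec_mulVec, mul_assoc, hU, mul_one, ← mulVec_mulVec, hv, mulVec_smul,
      smul_smul]
  have hν' : (ν : ℂ) ≠ 0 := by exact_mod_cast hν.ne'
  have hBA : U * B * Uᴴ = (ν : ℂ)⁻¹ • A := by rw [hAU, inv_smul_smul₀ hν']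
  have key := kthSmallest_eigenvalues hA (hUne (hv₀i x)) (hUne (hv₁i x)) (hAv hv₀) (hAv hv₁)
    (by simpa using mul_lt_mul_of_pos_left hlt hν) ?_
  · rw [key.1, key.2]
    simp
    ring
  · intro c hc w hw hw₀ hw₁
    have hstar : ∀ v : ι → ℂ, star (U *ᵥ v) ⬝ᵥ w = star v ⬝ᵥ (Uᴴ *ᵥ w) := fun v => by
      rw [star_mulVec, dotProduct_mulVec]
    have hz : Uᴴ *ᵥ w = 0 := by
      refine eq_zero_of_perturbed_diagonal (M := of fun j k => X j k x)
        (t := d i₁ + γ) (γ := γ) (c := ν⁻¹ * c) hdγ hX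
        (hv₀i x) (hv₁i x) hs₀ hs₁ ?_ ?_ ((hstar _).symm.trans hw₀) ((hstar _).symm.trans hw₁)
      · rw [inv_mul_le_iff₀ hν]
        refine hc.trans ?_
        simpa using mul_le_mul_of_nonneg_left hle.le hν.le
      · have : B * Uᴴ = Uᴴ * ((ν : ℂ)⁻¹ • A) := by
          rw [← hBA, ← mul_assoc, ← mul_assoc, hU, one_mul]
        rw [← hB, mulVec_mulVec, this, ← mulVec_mulVec, smul_mulVec, hw, mulVec_smul, mulVec_smul,
          smul_smul]
        push_cast
        rfl
    rw [← one_mulVec w, ← hU', ← mulVec_mulVec, hz, mulVec_zero]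

end EigenvalueBranch

section PauliStrings

variable {n : ℕ}

/-- The tensor product of single-qubit matrices. -/
def qubitTensor (M : Fin n → Matrix (Fin 2) (Fin 2) ℂ) :
    Matrix (Fin n → Fin 2) (Fin n → Fin 2) ℂ :=
  fun x y => ∏ j, M j (x j) (y j)

theorem sum_prod_pi {ι κ R : Type*} [Fintype ι] [DecidableEq ι] [Fintype κ] [CommSemiring R]
    (f : ι → κ → R) : ∑ x : ι → κ, ∏ i, f i (x i) = ∏ i, ∑ y, f i y := by
  rw [Finset.prod_univ_sum, Fintype.piFinset_univ]

theorem qubitTensor_mul (M N : Fin n → Matrix (Fin 2) (Fin 2) ℂ) :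
    qubitTensor M * qubitTensor N = qubitTensor fun j => M j * N j := by
  ext x y
  simp only [qubitTensor, mul_apply, ← Finset.prod_mul_distrib]
  exact sum_prod_pi fun j z => M j (x j) z * N j z (y j)

theorem qubitTensor_conjTranspose (M : Fin n → Matrix (Fin 2) (Fin 2) ℂ) :
    (qubitTensor M)ᴴ = qubitTensor fun j => (M j)ᴴ := by
  ext x y
  simp [qubitTensor, conjTranspose_apply]

theorem qubitTensor_diagonal (f : Fin n → Fin 2 → ℂ) :
    qubitTensor (fun j => diagonal (f j)) = diagonal fun y => ∏ j, f j (y j) := by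
  ext x y
  by_cases h : x = y
  · subst h; simp [qubitTensor]
  · obtain ⟨j, hj⟩ := Function.ne_iff.1 h
    rw [diagonal_apply_ne _ h]
    exact Finset.prod_eq_zero (Finset.mem_univ j) (diagonal_apply_ne _ hj)

theorem qubitTensor_one : qubitTensor (fun _ : Fin n => 1) = 1 := by
  simp_rw [← diagonal_one, qubitTensor_diagonal]
  simp

theorem pauliString_eq_qubitTensor (a : Fin n → Fin 4) :
    pauliString a = qubitTensor fun j => pauli (a j) := rfl

theorem pauli_isHermitian (a : Fin 4) : (pauli a).IsHermitian := by
  fin_cases a <;> ext i j <;> fin_cases i <;> fin_cases j <;> simp [pauli]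

theorem pauliString_isHermitian (a : Fin n → Fin 4) : (pauliString a).IsHermitian := by
  rw [IsHermitian, pauliString_eq_qubitTensor, qubitTensor_conjTranspose]
  simp_rw [(pauli_isHermitian _).eq]

theorem Htot_isHermitian (lam : PIdx n → ℝ) (ν : ℝ) (k : Fin n) (s : Fin n → Fin 2)
    (β : Fin n → Fin 3) : (Htot lam ν k s β).IsHermitian := by
  have hs : ∀ a : Fin 2, star ((-1 : ℂ) ^ (a : ℕ)) = (-1) ^ (a : ℕ) := fun a => by simp
  simp only [IsHermitian, Htot, Hmat, Hctrl, pauliAt, conjTranspose_sub, conjTranspose_add,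
    conjTranspose_smul, conjTranspose_sum, (pauliString_isHermitian _).eq]
  simp

/-- A unitary diagonalizing the Pauli matrix `σ^(b+1)`. -/
noncomputable def pauliFrame : Fin 3 → Matrix (Fin 2) (Fin 2) ℂ
  | 0 => (⟨1 / 2, 1 / 2⟩ : ℂ) • !![1, 1; 1, -1]
  | 1 => (⟨1 / 2, 1 / 2⟩ : ℂ) • !![1, 1; Complex.I, -Complex.I]
  | 2 => 1

/-- The diagonal entries of `σ^a` in an eigenbasis of `σ^(b+1)`. -/
noncomputable def pauliSign (a : Fin 4) (b : Fin 3) (y : Fin 2) : ℝ :=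
  if a = 0 then 1 else if a = b.succ then (-1) ^ (y : ℕ) else 0

theorem pauliFrame_conjTranspose_mul (b : Fin 3) : (pauliFrame b)ᴴ * pauliFrame b = 1 := by
  fin_cases b <;> ext i j <;> fin_cases i <;> fin_cases j <;>
    simp [pauliFrame, mul_apply, conjTranspose_apply, Fin.sum_univ_two, Complex.ext_iff] <;>
    norm_num

theorem pauliFrame_conj_diag (a : Fin 4) (b : Fin 3) (y : Fin 2) :
    ((pauliFrame b)ᴴ * pauli a * pauliFrame b) y y = pauliSign a b y := by
  fin_cases b <;> fin_cases a <;> fin_cases y <;>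
    simp [pauliFrame, pauliSign, pauli, mul_apply, Fin.sum_univ_two, Complex.ext_iff] <;> norm_num

theorem pauliFrame_conj_succ (b : Fin 3) :
    (pauliFrame b)ᴴ * pauli b.succ * pauliFrame b =
      diagonal fun y : Fin 2 => (-1 : ℂ) ^ (y : ℕ) := by
  fin_cases b <;> ext i j <;> fin_cases i <;> fin_cases j <;>
    simp [pauliFrame, pauli, mul_apply, Fin.sum_univ_two, Complex.ext_iff] <;> norm_num

/-- The product basis in which the control Hamiltonian is diagonal. -/
noncomputable def controlFrame (β : Fin n → Fin 3) : Matrix (Fin n → Fin 2) (Fin n → Fin 2) ℂ :=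
  qubitTensor fun j => pauliFrame (β j)

theorem controlFrame_conjTranspose_mul (β : Fin n → Fin 3) :
    (controlFrame β)ᴴ * controlFrame β = 1 := by
  simp_rw [controlFrame, qubitTensor_conjTranspose, qubitTensor_mul, pauliFrame_conjTranspose_mul,
    qubitTensor_one]

theorem controlFrame_mul_conjTranspose (β : Fin n → Fin 3) :
    controlFrame β * (controlFrame β)ᴴ = 1 :=
  mul_eq_one_comm.1 (controlFrame_conjTranspose_mul β)

theorem controlFrame_conj_pauliString (β : Fin n → Fin 3) (a : Fin n → Fin 4) :
    (controlFrame β)ᴴ * pauliString a * controlFrame β =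
      qubitTensor fun j => (pauliFrame (β j))ᴴ * pauli (a j) * pauliFrame (β j) := by
  rw [controlFrame, pauliString_eq_qubitTensor, qubitTensor_conjTranspose, qubitTensor_mul,
    qubitTensor_mul]

/-- The diagonal entries of a Pauli string in the control frame. -/
noncomputable def pauliStringSign (a : Fin n → Fin 4) (s : Fin n → Fin 2) (β : Fin n → Fin 3) : ℝ :=
  ∏ j, pauliSign (a j) (β j) (s j)

theorem controlFrame_conj_pauliString_diag (β : Fin n → Fin 3) (a : Fin n → Fin 4)
    (s : Fin n → Fin 2) :
    ((controlFrame β)ᴴ * pauliString a * controlFrame β) s s = pauliStringSign a s β := by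
  rw [controlFrame_conj_pauliString]
  simp [qubitTensor, pauliFrame_conj_diag, pauliStringSign]

theorem controlFrame_conj_pauliAt (β : Fin n → Fin 3) (j : Fin n) :
    (controlFrame β)ᴴ * pauliAt j (β j) * controlFrame β =
      diagonal fun y : Fin n → Fin 2 => (-1 : ℂ) ^ (y j : ℕ) := by
  have h : ∀ i, (pauliFrame (β i))ᴴ * pauli (if i = j then (β j).succ else 0) * pauliFrame (β i) =
      diagonal fun t : Fin 2 => if i = j then (-1) ^ (t : ℕ) else 1 := by
    intro i
    by_cases hi : i = j
    · subst hi; simp only [if_true]; exact pauliFrame_conj_succ _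
    · simp [hi, pauli, pauliFrame_conjTranspose_mul]
  rw [pauliAt, controlFrame_conj_pauliString]
  simp_rw [h, qubitTensor_diagonal]
  simp

/-- The eigenvalues of minus the control Hamiltonian. -/
noncomputable def controlEnergy (k : Fin n) (s y : Fin n → Fin 2) : ℝ :=
  ∑ j, (if j = k then 1 / 2 else 1) * (if s j = y j then -1 else 1)

theorem controlFrame_conj_Hctrl (k : Fin n) (s : Fin n → Fin 2) (β : Fin n → Fin 3) :
    (controlFrame β)ᴴ * Hctrl k s β * controlFrame β =
      -diagonal fun y => (controlEnergy k s y : ℂ) := by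
  have hsign : ∀ a b : Fin 2, (-1 : ℂ) ^ (a : ℕ) * (-1) ^ (b : ℕ) = -(if a = b then -1 else 1) := by
    intro a b
    fin_cases a <;> fin_cases b <;> simp
  rw [Hctrl, mul_add, add_mul, Finset.mul_sum, Finset.sum_mul]
  simp only [mul_smul_comm, smul_mul_assoc, controlFrame_conj_pauliAt]
  ext x y
  by_cases h : x = y
  · subst h
    simp only [Matrix.add_apply, Matrix.sum_apply, Matrix.smul_apply, diagonal_apply_eq,
      Matrix.neg_apply, smul_eq_mul, hsign, controlEnergy]
    rw [← Finset.add_sum_erase _ _ (Finset.mem_univ k), add_comm]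
    rw [div_mul_eq_mul_div, hsign]
    push_cast
    rw [neg_add, ← Finset.sum_neg_distrib]
    congr 1
    · rw [if_pos rfl]
      split_ifs <;> norm_num
    · refine Finset.sum_congr rfl fun j hj => ?_
      split_ifs <;> simp_all
  · simp [h, Matrix.sum_apply]

/-- Flipping the `k`-th bit. -/
def flipBit (k : Fin n) (s : Fin n → Fin 2) : Fin n → Fin 2 := Function.update s k (s k + 1)

theorem flipBit_involutive (k : Fin n) : Function.Involutive (flipBit k) := by
  intro s
  ext j
  by_cases hj : j = k
  · subst hj
    have : ∀ t : Fin 2, t + 1 + 1 = t := by decide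
    simp [flipBit, this]
  · simp [flipBit, hj]

theorem controlEnergy_self_lt (k : Fin n) (s : Fin n → Fin 2) :
    controlEnergy k s s < controlEnergy k s (flipBit k s) := by
  have hk : s k ≠ s k + 1 := by
    have : ∀ t : Fin 2, t ≠ t + 1 := by decide
    exact this _
  refine Finset.sum_lt_sum (fun j _ => ?_) ⟨k, Finset.mem_univ k, ?_⟩
  · rw [if_pos rfl]
    split_ifs <;> norm_num
  · simp [flipBit, hk]

theorem controlEnergy_flipBit_lt (k : Fin n) (s y : Fin n → Fin 2) (hs : y ≠ s)
    (hf : y ≠ flipBit k s) : controlEnergy k s (flipBit k s) < controlEnergy k s y := by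
  have hk : s k ≠ s k + 1 := by
    have : ∀ t : Fin 2, t ≠ t + 1 := by decide
    exact this _
  obtain ⟨j, hjk, hj⟩ : ∃ j, j ≠ k ∧ s j ≠ y j := by
    by_contra! hcon
    by_cases h : y k = s k
    · exact hs (funext fun j => if hj : j = k then hj ▸ h else (hcon j hj).symm)
    · refine hf (funext fun j => ?_)
      by_cases hj : j = k
      · subst hj
        have : ∀ t u : Fin 2, u ≠ t → u = t + 1 := by decide
        simpa [flipBit] using this _ _ h
      · simp [flipBit, hj, (hcon j hj).symm]
  have hj' : j ∈ Finset.univ.erase k := by simp [hjk]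
  rw [controlEnergy, controlEnergy, ← Finset.add_sum_erase _ _ (Finset.mem_univ k),
    ← Finset.add_sum_erase _ _ (Finset.mem_univ k), ← Finset.add_sum_erase _ _ hj',
    ← Finset.add_sum_erase _ _ hj']
  have h1 : ∑ i ∈ (Finset.univ.erase k).erase j,
      (if i = k then 1 / 2 else 1 : ℝ) * (if s i = flipBit k s i then -1 else 1) ≤
      ∑ i ∈ (Finset.univ.erase k).erase j,
        (if i = k then 1 / 2 else 1 : ℝ) * (if s i = y i then -1 else 1) := by
    refine Finset.sum_le_sum fun i hi => ?_
    have hik : i ≠ k := Finset.ne_of_mem_erase (Finset.mem_of_mem_erase hi)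
    simp only [flipBit, hik, if_false, Function.update_of_ne hik]
    split_ifs <;> norm_num
  have h2 : (-1 / 2 : ℝ) ≤ (if k = k then 1 / 2 else 1 : ℝ) * (if s k = y k then -1 else 1) := by
    rw [if_pos rfl]
    split_ifs <;> norm_num
  simp only [flipBit, Function.update_of_ne hjk, hjk, hj, if_true, if_false,
    Function.update_self, hk] at h1 h2 ⊢
  linarith

theorem pauliStringSign_flipBit (a : Fin n → Fin 4) (k : Fin n) (hk : a k ≠ 0) (s : Fin n → Fin 2)
    (β : Fin n → Fin 3) : pauliStringSign a (flipBit k s) β = -pauliStringSign a s β := by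
  have hsign : ∀ t : Fin 2, pauliSign (a k) (β k) (t + 1) = -pauliSign (a k) (β k) t := by
    intro t
    fin_cases t <;> simp [pauliSign, hk] <;> split_ifs <;> norm_num
  rw [pauliStringSign, pauliStringSign, ← Finset.mul_prod_erase _ _ (Finset.mem_univ k),
    ← Finset.mul_prod_erase _ _ (Finset.mem_univ k), ← neg_mul]
  congr 1
  · simp [flipBit, hsign]
  · exact Finset.prod_congr rfl fun j hj => by simp [flipBit, Finset.ne_of_mem_erase hj]

theorem sum_pauliSign_mul (a b : Fin 4) :
    ∑ y, ∑ c, pauliSign a c y * pauliSign b c y =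
      if a = b then (if a = 0 then 6 else 2) else 0 := by
  fin_cases a <;> fin_cases b <;>
    simp [pauliSign, Fin.sum_univ_succ] <;> norm_num

theorem sum_pauliStringSign_mul (a b : Fin n → Fin 4) :
    ∑ s, ∑ β, pauliStringSign a s β * pauliStringSign b s β =
      ∏ j, if a j = b j then (if a j = 0 then 6 else 2) else 0 := by
  simp_rw [pauliStringSign, ← Finset.prod_mul_distrib]
  calc _ = ∑ s : Fin n → Fin 2, ∏ j, ∑ c, pauliSign (a j) c (s j) * pauliSign (b j) c (s j) :=
        Finset.sum_congr rfl fun s _ =>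
          sum_prod_pi fun j c => pauliSign (a j) c (s j) * pauliSign (b j) c (s j)
    _ = ∏ j, ∑ y, ∑ c, pauliSign (a j) c y * pauliSign (b j) c y :=
        sum_prod_pi fun j y => ∑ c, pauliSign (a j) c y * pauliSign (b j) c y
    _ = _ := by simp_rw [sum_pauliSign_mul]

/-- The first-order gap variations determine the Hamiltonian. -/
theorem eq_zero_of_sum_flipBit_eq {x : PIdx n → ℝ}
    (h : ∀ k s β, ∑ a, x a * pauliStringSign a.val (flipBit k s) β =
      ∑ a, x a * pauliStringSign a.val s β) : x = 0 := by
  funext b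
  obtain ⟨k, hk⟩ := Function.ne_iff.1 b.2
  set S : ℝ := ∑ s, ∑ β, (∑ a, x a * pauliStringSign a.val s β) * pauliStringSign b.val s β with hS
  have hneg : S = -S := by
    conv_lhs => rw [hS, ← (flipBit_involutive k).bijective.sum_comp
      fun s => ∑ β, (∑ a, x a * pauliStringSign a.val s β) * pauliStringSign b.val s β]
    simp only [h, pauliStringSign_flipBit b.val k hk, mul_neg, Finset.sum_neg_distrib, hS]
  have hval : S = x b * ∏ j, if b.val j = 0 then 6 else 2 := by
    calc S = ∑ a, x a * ∑ s, ∑ β, pauliStringSign a.val s β * pauliStringSign b.val s β := by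
          simp_rw [hS, Finset.sum_mul, Finset.mul_sum, mul_assoc]
          exact (Finset.sum_congr rfl fun s _ => Finset.sum_comm).trans Finset.sum_comm
      _ = _ := by
          rw [Finset.sum_eq_single b]
          · rw [sum_pauliStringSign_mul]; simp
          · intro a _ hab
            obtain ⟨j, hj⟩ := Function.ne_iff.1 (Subtype.coe_ne_coe.2 hab)
            rw [sum_pauliStringSign_mul, Finset.prod_eq_zero (Finset.mem_univ j) (if_neg hj),
              mul_zero]
          · simp
  have hS0 : S = 0 := by linarith
  have hprod : (∏ j, if b.val j = 0 then 6 else 2 : ℝ) ≠ 0 :=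
    Finset.prod_ne_zero_iff.2 fun j _ => by split_ifs <;> norm_num
  exact (mul_eq_zero.1 (hval.symm.trans hS0)).resolve_right hprod

end PauliStrings

section GapMap

variable {n : ℕ}

/-- The matrix entries of the Hamiltonian in the control frame, as functions of its coefficients. -/
noncomputable def frameEntry (β : Fin n → Fin 3) (y z : Fin n → Fin 2) :
    EuclideanSpace ℝ (PIdx n) →L[ℝ] ℂ :=
  ∑ a : PIdx n, (EuclideanSpace.proj a : EuclideanSpace ℝ (PIdx n) →L[ℝ] ℝ).smulRight
    (((controlFrame β)ᴴ * pauliString a.val * controlFrame β) y z)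

theorem frameEntry_apply (β : Fin n → Fin 3) (y z : Fin n → Fin 2)
    (x : EuclideanSpace ℝ (PIdx n)) :
    frameEntry β y z x = ((controlFrame β)ᴴ * Hmat x.ofLp * controlFrame β) y z := by
  simp [frameEntry, Hmat, Finset.mul_sum, Finset.sum_mul, Matrix.sum_apply]

theorem re_frameEntry_diag (β : Fin n → Fin 3) (y : Fin n → Fin 2)
    (x : EuclideanSpace ℝ (PIdx n)) :
    (frameEntry β y y x).re = ∑ a : PIdx n, x a * pauliStringSign a.val y β := by
  simp [frameEntry, controlFrame_conj_pauliString_diag]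

theorem Htot_smul_eq (x : EuclideanSpace ℝ (PIdx n)) (ν : ℝ) (k : Fin n) (s : Fin n → Fin 2)
    (β : Fin n → Fin 3) :
    Htot (ν • x).ofLp ν k s β = (ν : ℂ) • (controlFrame β *
      (diagonal (fun y => (controlEnergy k s y : ℂ)) + of fun y z => frameEntry β y z x) *
      (controlFrame β)ᴴ) := by
  have hH : Hmat (ν • x).ofLp = (ν : ℂ) • Hmat x.ofLp := by
    simp only [Hmat, Finset.smul_sum, smul_smul, PiLp.smul_apply, smul_eq_mul, Complex.ofReal_mul]
  have hX : (of fun y z => frameEntry β y z x) =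
      (controlFrame β)ᴴ * Hmat x.ofLp * controlFrame β := by
    ext y z
    exact frameEntry_apply β y z x
  have hD : diagonal (fun y => (controlEnergy k s y : ℂ)) =
      (controlFrame β)ᴴ * (-Hctrl k s β) * controlFrame β := by
    rw [mul_neg, neg_mul, controlFrame_conj_Hctrl, neg_neg]
  have hU : ∀ A, controlFrame β * ((controlFrame β)ᴴ * A * controlFrame β) * (controlFrame β)ᴴ =
      A := by
    intro A
    calc _ = controlFrame β * (controlFrame β)ᴴ * A * (controlFrame β * (controlFrame β)ᴴ) := by
          simp only [Matrix.mul_assoc]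
      _ = A := by rw [controlFrame_mul_conjTranspose, Matrix.one_mul, Matrix.mul_one]
  rw [Htot, hH, hX, hD, mul_add, add_mul, hU, hU, smul_add, smul_neg, neg_add_eq_sub]

/-- Near `0`, the rescaled gaps are an analytic immersion that does not depend on `ν`. -/
theorem exists_gapMap (n : ℕ) :
    ∃ F : EuclideanSpace ℝ (PIdx n) → EuclideanSpace ℝ (EIdx n), ContDiffAt ℝ ω F 0 ∧
      Function.Injective (fderiv ℝ F 0) ∧
      ∀ᶠ x in 𝓝 0, ∀ ν : ℝ, 0 < ν → EvecE (ν • x) ν = ν • F x := by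
  have hbranch := fun p : EIdx n => exists_gap_branch (controlEnergy p.1 p.2.1)
    (controlEnergy_self_lt p.1 p.2.1) (controlEnergy_flipBit_lt p.1 p.2.1) (frameEntry p.2.2)
  choose f hf hf' hgap using hbranch
  have hFd : HasFDerivAt (fun x => WithLp.toLp 2 fun p => f p x)
      ((PiLp.continuousLinearEquiv 2 ℝ fun _ : EIdx n => ℝ).symm.toContinuousLinearMap ∘L
        ContinuousLinearMap.pi fun p : EIdx n =>
          Complex.reCLM ∘L (frameEntry p.2.2 (flipBit p.1 p.2.1) (flipBit p.1 p.2.1) -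
            frameEntry p.2.2 p.2.1 p.2.1)) 0 :=
    ((PiLp.continuousLinearEquiv 2 ℝ fun _ : EIdx n => ℝ).symm.hasFDerivAt).comp 0
      (hasFDerivAt_pi.2 hf')
  refine ⟨fun x => WithLp.toLp 2 fun p => f p x, contDiffAt_euclidean.2 hf, ?_, ?_⟩
  · rw [hFd.fderiv, injective_iff_map_eq_zero]
    intro x hx
    suffices x.ofLp = 0 from (WithLp.ofLp_eq_zero 2).1 this
    refine eq_zero_of_sum_flipBit_eq fun k s β => ?_
    rw [← sub_eq_zero, ← re_frameEntry_diag, ← re_frameEntry_diag]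
    simpa using congrArg (fun v : EuclideanSpace ℝ (EIdx n) => v (k, s, β)) hx
  · filter_upwards [Filter.eventually_all.2 hgap] with x hx ν hν
    ext p
    have hH := Htot_isHermitian (ν • x).ofLp ν p.1 p.2.1 p.2.2
    exact (dif_pos hH).trans (hx p ν hν (controlFrame p.2.2) _ hH
      (controlFrame_conjTranspose_mul _) (controlFrame_mul_conjTranspose _)
      (Htot_smul_eq x ν p.1 p.2.1 p.2.2))

end GapMap

section LeastSquares

variable {X Y : Type*} [NormedAddCommGroup X] [InnerProductSpace ℝ X]
  [NormedAddCommGroup Y] [InnerProductSpace ℝ Y]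

/-- If `F` is analytic and immersive at `x₀`, then near `F x₀` the critical point equation of the
least-squares loss has an analytic solution branch which is a left inverse of `F`. -/
theorem exists_leastSquares_branch [FiniteDimensional ℝ X] [FiniteDimensional ℝ Y] {F : X → Y}
    {x₀ : X} (hF : ContDiffAt ℝ ω F x₀) (hinj : Function.Injective (fderiv ℝ F x₀)) :
    ∃ h : Y → X, ContDiffAt ℝ ω h (F x₀) ∧ h (F x₀) = x₀ ∧ (∀ᶠ x in 𝓝 x₀, h (F x) = x) ∧
      ∀ᶠ y in 𝓝 (F x₀), (innerSL ℝ (y - F (h y))) ∘L fderiv ℝ F (h y) = 0 := by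
  have := FiniteDimensional.complete ℝ X
  have := FiniteDimensional.complete ℝ Y
  set Φ : Y × X → (X →L[ℝ] ℝ) := fun p => (innerSL ℝ (p.1 - F p.2)) ∘L fderiv ℝ F p.2 with hΦ
  have hF2 : ContDiffAt ℝ ω (fun p : Y × X => F p.2) (F x₀, x₀) :=
    hF.comp (F x₀, x₀) contDiffAt_snd
  have hdF : ContDiffAt ℝ ω (fderiv ℝ F) x₀ := hF.fderiv_right (by simp)
  have hdF2 : ContDiffAt ℝ ω (fun p : Y × X => fderiv ℝ F p.2) (F x₀, x₀) :=
    hdF.comp (F x₀, x₀) contDiffAt_snd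
  have hin : ContDiffAt ℝ ω (fun p : Y × X => innerSL ℝ (p.1 - F p.2)) (F x₀, x₀) :=
    (innerSL ℝ (E := Y)).contDiff.contDiffAt.comp (F x₀, x₀) (contDiffAt_fst.sub hF2)
  have hΦc : ContDiffAt ℝ ω Φ (F x₀, x₀) := hin.clm_comp hdF2
  have hΦ0 : Φ (F x₀, x₀) = 0 := by simp [hΦ]
  have hder : fderiv ℝ Φ (F x₀, x₀) ∘L .inr ℝ Y X =
      -((ContinuousLinearMap.compL ℝ X Y ℝ).flip (fderiv ℝ F x₀)) ∘L
        ((innerSL ℝ (E := Y)) ∘L (fderiv ℝ F x₀)) := by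
    have h1 : HasFDerivAt (fun p : Y × X => p.1 - F p.2)
        (ContinuousLinearMap.fst ℝ Y X - (fderiv ℝ F x₀) ∘L ContinuousLinearMap.snd ℝ Y X)
        (F x₀, x₀) :=
      hasFDerivAt_fst.sub
        (HasFDerivAt.comp (F x₀, x₀) (g := F) (f := Prod.snd)
          (hF.differentiableAt (by simp)).hasFDerivAt hasFDerivAt_snd)
    have h2 := ((innerSL ℝ (E := Y)).hasFDerivAt (x := F x₀ - F x₀)).comp (F x₀, x₀) h1
    have h3 := (hdF2.differentiableAt (by simp)).hasFDerivAt
    have h4 := h2.clm_comp h3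
    have h5 : HasFDerivAt Φ _ (F x₀, x₀) := h4
    rw [h5.fderiv]
    ext v w
    simp
  have hinv : (fderiv ℝ Φ (F x₀, x₀) ∘L .inr ℝ Y X).IsInvertible := by
    rw [hder]
    set T := -((ContinuousLinearMap.compL ℝ X Y ℝ).flip (fderiv ℝ F x₀)) ∘L
        ((innerSL ℝ (E := Y)) ∘L (fderiv ℝ F x₀)) with hT
    have hTi : Function.Injective T := by
      rw [injective_iff_map_eq_zero]
      intro v hv
      have hTv : T v v = 0 := by rw [hv]; rfl
      have hinner : inner ℝ (fderiv ℝ F x₀ v) (fderiv ℝ F x₀ v) = 0 := neg_eq_zero.1 hTv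
      exact hinj (by simpa using hinner)
    exact isInvertible_of_injective hTi (InnerProductSpace.toDual ℝ X).toLinearEquiv.finrank_eq
  refine ⟨hΦc.implicitFunction (by simp) hinv, hΦc.contDiffAt_implicitFunction (by simp) hinv,
    hΦc.implicitFunction_apply_self (by simp) hinv, ?_, ?_⟩
  · have h1 := hΦc.eventually_apply_eq_iff_implicitFunction (by simp) hinv
    have h2 : Filter.Tendsto (fun x => (F x, x)) (𝓝 x₀) (𝓝 (F x₀, x₀)) :=
      (hF.continuousAt.prodMk continuousAt_id)
    filter_upwards [h2.eventually h1] with x hx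
    exact hx.1 (by rw [hΦ0]; simp [hΦ])
  · filter_upwards [hΦc.eventually_apply_implicitFunction (by simp) hinv] with y hy
    rw [hΦ0] at hy
    exact hy

/-- Rescaling a local least-squares branch of `F` gives critical points of the loss with respect to
any map `E` that agrees with `ν • F (ν⁻¹ • ·)`. -/
theorem hasFDerivAt_loss_of_scaled {F E : X → Y} {ν : ℝ} (hν : 0 < ν) {x : X} {y : Y}
    (hF : DifferentiableAt ℝ F x) (hcrit : (innerSL ℝ (y - F x)) ∘L fderiv ℝ F x = 0)
    (hE : ∀ᶠ z in 𝓝 x, E (ν • z) = ν • F z) :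
    HasFDerivAt (fun μ => (1 / 2) * ‖ν • y - E μ‖ ^ 2) (0 : X →L[ℝ] ℝ) (ν • x) := by
  have hlim : Filter.Tendsto (fun μ : X => ν⁻¹ • μ) (𝓝 (ν • x)) (𝓝 x) := by
    have : Continuous (fun μ : X => ν⁻¹ • μ) := by fun_prop
    simpa [smul_smul, hν.ne'] using this.tendsto (ν • x)
  have hEq : (fun μ => (1 / 2) * ‖ν • y - E μ‖ ^ 2) =ᶠ[𝓝 (ν • x)]
      fun μ => (1 / 2) * ‖ν • y - ν • F (ν⁻¹ • μ)‖ ^ 2 := by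
    filter_upwards [hlim.eventually hE] with μ hμ
    rw [smul_inv_smul₀ hν.ne'] at hμ
    rw [hμ]
  refine HasFDerivAt.congr_of_eventuallyEq ?_ hEq
  have h1 : HasFDerivAt (fun μ : X => ν⁻¹ • μ) (ν⁻¹ • ContinuousLinearMap.id ℝ X) (ν • x) :=
    (hasFDerivAt_id _).const_smul _
  have hx : ν⁻¹ • (ν • x) = x := inv_smul_smul₀ hν.ne' x
  have h2 : HasFDerivAt F (fderiv ℝ F x) (ν⁻¹ • (ν • x)) := by rw [hx]; exact hF.hasFDerivAt
  have h3 := (((h2.comp (ν • x) h1).const_smul ν).const_sub (ν • y)).norm_sq.const_mul (1 / 2)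
  refine h3.congr_fderiv ?_
  ext v
  have := congrArg (fun T : X →L[ℝ] ℝ => T v) hcrit
  simp only [ContinuousLinearMap.comp_apply, innerSL_apply_apply, _root_.zero_apply]
    at this
  rw [inner_sub_left] at this
  simp [hx, ← smul_sub, innerSL_apply_apply, this]

end LeastSquares

/-- For each `n ≥ 1` there are constants `ν₀, r, C > 0` (depending only on `n`)
such that for any coefficients `λ` with `|λ_a| ≤ 1` and any `ν ≥ ν₀`, there is a `C^∞` map `g`
on the ball of radius `r` around `E* = E(λ,ν)` with `g(E*) = λ`, whose value `g(Ê)` is a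
critical point of `μ ↦ L(Ê, μ, ν)`, and which satisfies `‖g(Ê) − λ‖ ≤ C‖Ê − E*‖`. -/
theorem stmt_12 (n : ℕ) (hn : 1 ≤ n) :
    ∃ ν₀ > (0 : ℝ), ∃ r > (0 : ℝ), ∃ C > (0 : ℝ),
      ∀ lam : EuclideanSpace ℝ (PIdx n), (∀ a, |lam a| ≤ 1) →
      ∀ ν : ℝ, ν₀ ≤ ν →
      ∃ g : EuclideanSpace ℝ (EIdx n) → EuclideanSpace ℝ (PIdx n),
        g (EvecE lam ν) = lam ∧
        ContDiffOn ℝ (⊤ : ℕ∞) g (Metric.ball (EvecE lam ν) r) ∧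
        ∀ Ehat ∈ Metric.ball (EvecE lam ν) r,
          HasFDerivAt (fun μ => Lloss Ehat μ ν)
            (0 : EuclideanSpace ℝ (PIdx n) →L[ℝ] ℝ) (g Ehat) ∧
          ‖g Ehat - lam‖ ≤ C * ‖Ehat - EvecE lam ν‖ := by
  obtain ⟨F, hF, hinj, hE⟩ := exists_gapMap n
  obtain ⟨h, hh, hh0, hhF, hcrit⟩ := exists_leastSquares_branch hF hinj
  obtain ⟨K, t, ht, hK⟩ := ContDiffAt.exists_lipschitzOnWith (hh.of_le le_top)
  have hlim : Filter.Tendsto h (𝓝 (F 0)) (𝓝 0) := by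
    have := hh.continuousAt.tendsto
    rwa [hh0] at this
  have hy : ∀ᶠ y in 𝓝 (F 0), ContDiffAt ℝ ω h y ∧ y ∈ t ∧
      (innerSL ℝ (y - F (h y))) ∘L fderiv ℝ F (h y) = 0 ∧ DifferentiableAt ℝ F (h y) ∧
      ∀ᶠ z in 𝓝 (h y), ∀ ν : ℝ, 0 < ν → EvecE (ν • z) ν = ν • F z := by
    filter_upwards [hh.eventually (by simp), ht, hcrit,
      hlim.eventually (hF.eventually (by simp)), hlim.eventually hE.eventually_nhds]
      with y h1 h2 h3 h4 h5
    exact ⟨h1, h2, h3, h4.differentiableAt (by simp), h5⟩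
  obtain ⟨η, hη, hball⟩ := Metric.eventually_nhds_iff_ball.1 hy
  have hx : ∀ᶠ x in 𝓝 (0 : EuclideanSpace ℝ (PIdx n)), h (F x) = x ∧
      F x ∈ Metric.ball (F 0) (η / 2) ∧ ∀ ν : ℝ, 0 < ν → EvecE (ν • x) ν = ν • F x := by
    filter_upwards [hhF, hF.continuousAt.eventually (Metric.ball_mem_nhds (F 0) (half_pos hη)), hE]
      with x h1 h2 h3
    exact ⟨h1, h2, h3⟩
  obtain ⟨ρ, hρ, hballx⟩ := Metric.eventually_nhds_iff_ball.1 hx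
  set M : ℝ := √(Fintype.card (PIdx n)) with hM
  have hM0 : 0 ≤ M := Real.sqrt_nonneg _
  refine ⟨1 + M / ρ, by positivity, η / 2, half_pos hη, K + 1, by positivity, ?_⟩
  intro lam hlam ν hν
  have hν1 : 1 ≤ ν := le_trans (by simp; positivity) hν
  have hν0 : 0 < ν := by linarith
  have hnorm : ‖lam‖ ≤ M := by
    rw [EuclideanSpace.norm_eq, hM]
    apply Real.sqrt_le_sqrt
    calc ∑ i, ‖lam i‖ ^ 2 ≤ ∑ i : PIdx n, (1 : ℝ) :=
          Finset.sum_le_sum fun i _ => pow_le_one₀ (norm_nonneg _) (hlam i)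
      _ = _ := by simp
  have hxl : ν⁻¹ • lam ∈ Metric.ball (0 : EuclideanSpace ℝ (PIdx n)) ρ := by
    rw [mem_ball_zero_iff, norm_smul, norm_inv, Real.norm_of_nonneg hν0.le, inv_mul_lt_iff₀ hν0]
    have : M / ρ < ν := by linarith
    rw [div_lt_iff₀ hρ] at this
    linarith
  obtain ⟨hl1, hl2, hl3⟩ := hballx _ hxl
  have hEl : EvecE lam ν = ν • F (ν⁻¹ • lam) := by
    rw [← hl3 ν hν0, smul_inv_smul₀ hν0.ne']
  have hmem : ∀ Ehat ∈ Metric.ball (EvecE lam ν) (η / 2),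
      ν⁻¹ • Ehat ∈ Metric.ball (F 0) η := by
    intro Ehat hEhat
    rw [hEl, mem_ball_iff_norm] at hEhat
    have h1 : ‖ν⁻¹ • Ehat - F (ν⁻¹ • lam)‖ < η / 2 := by
      have : ν⁻¹ • Ehat - F (ν⁻¹ • lam) = ν⁻¹ • (Ehat - ν • F (ν⁻¹ • lam)) := by
        rw [smul_sub, inv_smul_smul₀ hν0.ne']
      rw [this, norm_smul, norm_inv, Real.norm_of_nonneg hν0.le]
      refine lt_of_le_of_lt ?_ hEhat
      exact mul_le_of_le_one_left (norm_nonneg _) (inv_le_one_of_one_le₀ hν1)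
    rw [mem_ball_iff_norm] at hl2 ⊢
    have := norm_sub_le_norm_sub_add_norm_sub (ν⁻¹ • Ehat) (F (ν⁻¹ • lam)) (F 0)
    linarith
  have hself : ν⁻¹ • EvecE lam ν = F (ν⁻¹ • lam) := by rw [hEl, inv_smul_smul₀ hν0.ne']
  have hgl : ν • h (ν⁻¹ • EvecE lam ν) = lam := by rw [hself, hl1, smul_inv_smul₀ hν0.ne']
  refine ⟨fun Ehat => ν • h (ν⁻¹ • Ehat), hgl, ?_, ?_⟩
  · intro Ehat hEhat
    have h1 : ContDiffAt ℝ (⊤ : ℕ∞) h (ν⁻¹ • Ehat) := (hball _ (hmem _ hEhat)).1.of_le le_top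
    refine ContDiffAt.contDiffWithinAt (ContDiffAt.const_smul ν ?_)
    exact h1.comp Ehat (f := fun E => ν⁻¹ • E) (contDiffAt_id.const_smul _)
  · intro Ehat hEhat
    obtain ⟨_, h2, h3, h4, h5⟩ := hball _ (hmem _ hEhat)
    constructor
    · have := hasFDerivAt_loss_of_scaled (E := fun μ => EvecE μ ν) hν0 h4 h3
        (h5.mono fun z hz => hz ν hν0)
      rw [smul_inv_smul₀ hν0.ne'] at this
      exact this
    · have h6 := (hball _ (hmem _ (Metric.mem_ball_self (half_pos hη)))).2.1
      have h7 := hK.norm_sub_le h2 h6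
      calc ‖ν • h (ν⁻¹ • Ehat) - lam‖
          = ‖ν • h (ν⁻¹ • Ehat) - ν • h (ν⁻¹ • EvecE lam ν)‖ := by rw [hgl]
        _ = ν * ‖h (ν⁻¹ • Ehat) - h (ν⁻¹ • EvecE lam ν)‖ := by
            rw [← smul_sub, norm_smul, Real.norm_of_nonneg hν0.le]
        _ ≤ ν * (K * ‖ν⁻¹ • Ehat - ν⁻¹ • EvecE lam ν‖) := by gcongr
        _ = K * ‖Ehat - EvecE lam ν‖ := by
            rw [← smul_sub, norm_smul, norm_inv, Real.norm_of_nonneg hν0.le]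
            field_simp
        _ ≤ (K + 1) * ‖Ehat - EvecE lam ν‖ := by gcongr; linarith
end
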